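/- Fix q ≥ 2 and a constraint graph H on {0,…,q−1} that has an unconstrained vertex, i.e. a vertex s with (s,t) ∈ E(H) for every t ∈ {0,…,q−1} (including the self-loop at s). Then for every finite simple graph G on vertex set {1,…,N}, every b ∈ ℝ^{q−1}, and every r ∈ {1,…,q−1}, E_{σ∼P^N_b}[c_r(σ)] ≥ Σ_{u=1}^N 1/(1 + e^{‖b‖₁·(d_u(G)+1)}·q^{d_u(G)+1}), where ‖b‖₁ = Σ_{t=1}^{q−1}|b_t| and d_u(G) is the degree of u in G. -/

import Mathlib

open Finset Filter

open scoped Classical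

noncomputable section

/-- `σ` is an `H`-coloring of `G`: adjacent vertices of `G` receive adjacent colors
in the constraint graph `H` (given as a symmetric relation on `Fin q`, possibly with
self-loops). -/
def IsHColoring {q N : ℕ} (G : SimpleGraph (Fin N)) (H : Fin q → Fin q → Prop)
    (σ : Fin N → Fin q) : Prop :=
  ∀ u v : Fin N, G.Adj u v → H (σ u) (σ v)

/-- `c_s(σ)`: the number of vertices with color `s`. -/
def colCount {q N : ℕ} (s : Fin q) (σ : Fin N → Fin q) : ℕ :=
  (univ.filter fun u => σ u = s).card

/-- The vertex `u` is `s`-feasible for `σ`: every neighbor of `u` in `G` has a color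
in the `H`-neighborhood of `s`. -/
def feas {q N : ℕ} (G : SimpleGraph (Fin N)) (H : Fin q → Fin q → Prop)
    (σ : Fin N → Fin q) (u : Fin N) (s : Fin q) : Prop :=
  ∀ v : Fin N, G.Adj u v → H s (σ v)

/-- `u_r(σ)`: the number of `r`-feasible (i.e. `r`-unconstrained) vertices. -/
def uCount {q N : ℕ} (G : SimpleGraph (Fin N)) (H : Fin q → Fin q → Prop)
    (r : Fin q) (σ : Fin N → Fin q) : ℕ :=
  (univ.filter fun u => feas G H σ u r).card

/-- The degree of the vertex `u` in `G`. -/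
def deg {N : ℕ} (G : SimpleGraph (Fin N)) (u : Fin N) : ℕ :=
  (univ.filter fun v => G.Adj u v).card

/-- Unnormalized weight of a configuration in the `H`-coloring model with activity
parameters `b` (with the convention `b 0 = 0`). -/
def hWeight {q N : ℕ} (G : SimpleGraph (Fin N)) (H : Fin q → Fin q → Prop)
    (b : Fin q → ℝ) (σ : Fin N → Fin q) : ℝ :=
  if IsHColoring G H σ then Real.exp (∑ s : Fin q, b s * colCount s σ) else 0

/-- Probability of the event `A` under the `H`-coloring model `P^N_b` on `G`. -/
def hProb {q N : ℕ} (G : SimpleGraph (Fin N)) (H : Fin q → Fin q → Prop)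
    (b : Fin q → ℝ) (A : (Fin N → Fin q) → Prop) : ℝ :=
  (∑ σ : Fin N → Fin q, if A σ then hWeight G H b σ else 0) /
    ∑ σ : Fin N → Fin q, hWeight G H b σ

/-- Expectation of `f` under the `H`-coloring model `P^N_b` on `G`. -/
def hExp {q N : ℕ} (G : SimpleGraph (Fin N)) (H : Fin q → Fin q → Prop)
    (b : Fin q → ℝ) (f : (Fin N → Fin q) → ℝ) : ℝ :=
  (∑ σ : Fin N → Fin q, hWeight G H b σ * f σ) /
    ∑ σ : Fin N → Fin q, hWeight G H b σ

/-- `L^{(r)}_σ(b)`: the `r`-th coordinate of (1/N times) the gradient of the log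
pseudo-likelihood of the `H`-coloring model. -/
def Lr {q N : ℕ} (G : SimpleGraph (Fin N)) (H : Fin q → Fin q → Prop)
    (σ : Fin N → Fin q) (b : Fin q → ℝ) (r : Fin q) : ℝ :=
  (colCount r σ : ℝ) / N - (1 / N : ℝ) * ∑ u : Fin N,
    Real.exp (b r) * (if feas G H σ u r then 1 else 0) /
      ∑ s : Fin q, Real.exp (b s) * (if feas G H σ u s then 1 else 0)

lemma aux_energy {q N : ℕ} (b : Fin q → ℝ) (σ : Fin N → Fin q) :
    ∑ s : Fin q, b s * colCount s σ = ∑ v, b (σ v) := by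
  unfold colCount
  rw [← Finset.sum_fiberwise (s := univ) (g := σ)]
  refine Finset.sum_congr rfl fun s _ => ?_
  rw [Finset.sum_congr rfl (g := fun _ => b s)]
  · simp [mul_comm]
  · intro x hx
    simp at hx
    rw [hx]

/-- Recolor `u` with `r` and all its neighbors with `s`. -/
def auxT {q N : ℕ} (G : SimpleGraph (Fin N)) (u : Fin N) (r s : Fin q)
    (σ : Fin N → Fin q) : Fin N → Fin q :=
  fun v => if v = u then r else if G.Adj u v then s else σ v

lemma aux_card {N : ℕ} (G : SimpleGraph (Fin N)) (u : Fin N) :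
    (univ.filter fun v => v = u ∨ G.Adj u v).card = deg G u + 1 := by
  unfold deg
  rw [← Finset.card_insert_of_notMem (a := u)]
  · congr 1
    ext v
    simp
  · simp

lemma aux_diff {q : ℕ} (b : Fin q → ℝ) (x y : Fin q) :
    b x ≤ b y + ∑ t : Fin q, |b t| := by
  by_cases h : x = y
  · subst h
    have : 0 ≤ ∑ t : Fin q, |b t| := Finset.sum_nonneg fun _ _ => abs_nonneg _
    linarith
  · have h2 : ∑ t ∈ {x, y}, |b t| ≤ ∑ t : Fin q, |b t| :=
      Finset.sum_le_sum_of_subset_of_nonneg (Finset.subset_univ _) fun _ _ _ => abs_nonneg _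
    rw [Finset.sum_pair h] at h2
    have := le_abs_self (b x)
    have := neg_abs_le (b y)
    linarith

lemma aux_weight_nonneg {q N : ℕ} (G : SimpleGraph (Fin N)) (H : Fin q → Fin q → Prop)
    (b : Fin q → ℝ) (σ : Fin N → Fin q) : 0 ≤ hWeight G H b σ := by
  unfold hWeight
  split_ifs
  · exact (Real.exp_pos _).le
  · exact le_rfl

lemma aux_weight {q N : ℕ} (G : SimpleGraph (Fin N)) (H : Fin q → Fin q → Prop)
    (hsym : ∀ s t : Fin q, H s t → H t s) (b : Fin q → ℝ) (u : Fin N) (r s : Fin q)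
    (hs : ∀ t, H s t) (σ : Fin N → Fin q) :
    hWeight G H b σ ≤ Real.exp ((∑ t : Fin q, |b t|) * (deg G u + 1)) *
      hWeight G H b (auxT G u r s σ) := by
  by_cases hσ : IsHColoring G H σ
  · have hT : IsHColoring G H (auxT G u r s σ) := by
      intro v w hvw
      unfold auxT
      by_cases hv : v = u
      · subst hv
        have : w ≠ v := hvw.ne'
        simp [this, hvw, hsym _ _ (hs r)]
      · by_cases hw : w = u
        · subst hw
          simp [hv, hvw.symm, hs r]
        · simp only [hv, hw, if_false]
          split_ifs
          · exact hs _
          · exact hs _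
          · exact hsym _ _ (hs _)
          · exact hσ v w hvw
    unfold hWeight
    rw [if_pos hσ, if_pos hT, ← Real.exp_add, Real.exp_le_exp, aux_energy, aux_energy]
    have key : ∀ v, b (σ v) ≤ (if v = u ∨ G.Adj u v then ∑ t : Fin q, |b t| else 0) +
        b (auxT G u r s σ v) := by
      intro v
      split_ifs with h
      · linarith [aux_diff b (σ v) (auxT G u r s σ v)]
      · push Not at h
        simp [auxT, h.1, h.2]
    refine (Finset.sum_le_sum fun v _ => key v).trans ?_
    rw [Finset.sum_add_distrib, ← Finset.sum_filter, Finset.sum_const, aux_card, nsmul_eq_mul]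
    push_cast
    rw [mul_comm]
  · have : hWeight G H b σ = 0 := by simp [hWeight, hσ]
    rw [this]
    exact mul_nonneg (Real.exp_pos _).le (aux_weight_nonneg _ _ _ _)

lemma aux_fiber {q N : ℕ} (G : SimpleGraph (Fin N)) (u : Fin N) (r s : Fin q)
    (τ : Fin N → Fin q) :
    (univ.filter fun σ => auxT G u r s σ = τ).card ≤ q ^ (deg G u + 1) := by
  have hc : (univ : Finset ({v // v ∈ univ.filter fun v => v = u ∨ G.Adj u v} → Fin q)).card
      = q ^ (deg G u + 1) := by
    rw [Finset.card_univ, Fintype.card_fun, Fintype.card_fin, Fintype.card_coe, aux_card]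
  rw [← hc]
  refine Finset.card_le_card_of_injOn (fun σ v => σ v.1) (fun _ _ => Finset.mem_coe.2 (Finset.mem_univ _)) ?_
  intro σ hσ σ' hσ' h
  have h1 : auxT G u r s σ = τ := by simpa using hσ
  have h2 : auxT G u r s σ' = τ := by simpa using hσ'
  funext v
  by_cases hv : v = u ∨ G.Adj u v
  · exact congrFun h ⟨v, by simpa using hv⟩
  · have := congrFun (h1.trans h2.symm) v
    push Not at hv
    simpa [auxT, hv.1, hv.2] using this

lemma aux_vertex {q N : ℕ} (G : SimpleGraph (Fin N)) (H : Fin q → Fin q → Prop)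
    (hsym : ∀ s t : Fin q, H s t → H t s) (b : Fin q → ℝ) (u : Fin N) (r s : Fin q)
    (hs : ∀ t, H s t) :
    ∑ σ, hWeight G H b σ ≤
      Real.exp ((∑ t : Fin q, |b t|) * (deg G u + 1)) * (q : ℝ) ^ (deg G u + 1) *
        ∑ σ, hWeight G H b σ * (if σ u = r then 1 else 0) := by
  refine (Finset.sum_le_sum fun σ _ => aux_weight G H hsym b u r s hs σ).trans ?_
  rw [← Finset.mul_sum, mul_assoc]
  refine mul_le_mul_of_nonneg_left ?_ (Real.exp_pos _).le
  rw [← Finset.sum_fiberwise (s := univ) (g := auxT G u r s), Finset.mul_sum]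
  refine Finset.sum_le_sum fun τ _ => ?_
  by_cases hτ : τ u = r
  · rw [Finset.sum_congr rfl (g := fun _ => hWeight G H b τ)]
    · rw [Finset.sum_const, nsmul_eq_mul, if_pos hτ, mul_one]
      refine mul_le_mul_of_nonneg_right ?_ (aux_weight_nonneg _ _ _ _)
      exact_mod_cast aux_fiber G u r s τ
    · intro σ hσ
      simp at hσ
      rw [hσ]
  · rw [Finset.filter_false_of_mem]
    · simp [hτ]
    · rintro σ - rfl
      simp [auxT] at hτ

/-- if the constraint graph `H` has an unconstrained vertex, then the
expected number of vertices of any color `r ∈ {1,…,q−1}` is at least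
`Σ_u 1/(1 + e^{‖b‖₁(d_u+1)} q^{d_u+1})`. -/
theorem stmt15 (q : ℕ) [NeZero q] (hq : 2 ≤ q) {N : ℕ}
    (H : Fin q → Fin q → Prop) (hsym : ∀ s t : Fin q, H s t → H t s)
    (huncon : ∃ s : Fin q, ∀ t : Fin q, H s t)
    (G : SimpleGraph (Fin N)) (b : Fin q → ℝ) (hb0 : b 0 = 0)
    (r : Fin q) (hr : r ≠ 0) :
    ∑ u : Fin N,
        1 / (1 + Real.exp ((∑ t : Fin q, |b t|) * (deg G u + 1)) * (q : ℝ) ^ (deg G u + 1))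
      ≤ hExp G H b (fun σ => (colCount r σ : ℝ)) := by
  obtain ⟨s, hs⟩ := huncon
  have hZ : 0 < ∑ σ, hWeight G H b σ := by
    refine Finset.sum_pos' (fun σ _ => aux_weight_nonneg _ _ _ _) ⟨fun _ => s, mem_univ _, ?_⟩
    have : IsHColoring G H (fun _ => s) := fun _ _ _ => hs s
    simp [hWeight, this, Real.exp_pos]
  have hE : hExp G H b (fun σ => (colCount r σ : ℝ)) =
      ∑ u : Fin N, (∑ σ, hWeight G H b σ * (if σ u = r then 1 else 0)) /
        ∑ σ, hWeight G H b σ := by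
    unfold hExp
    rw [← Finset.sum_div, Finset.sum_comm]
    congr 1
    refine Finset.sum_congr rfl fun σ _ => ?_
    rw [← Finset.mul_sum]
    simp [colCount]
  rw [hE]
  refine Finset.sum_le_sum fun u _ => ?_
  have hv := aux_vertex G H hsym b u r s hs
  have hq0 : (0 : ℝ) < q := by exact_mod_cast (by omega : 0 < q)
  have hC : 0 < Real.exp ((∑ t : Fin q, |b t|) * (deg G u + 1)) * (q : ℝ) ^ (deg G u + 1) := by
    positivity
  have hA : 0 ≤ ∑ σ, hWeight G H b σ * (if σ u = r then (1 : ℝ) else 0) :=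
    Finset.sum_nonneg fun σ _ => mul_nonneg (aux_weight_nonneg _ _ _ _) (by split_ifs <;> norm_num)
  rw [div_le_div_iff₀ (by linarith) hZ]
  nlinarith
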